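/- Let $n>2s$, $\delta$-interacting bubbles $W_i$, $W_j$ with $\tilde s+\tilde t=2_s^*$, $\tilde s,\tilde t\ge0$. Then the integral restricted to the region where $W_i$ dominates satisfies: $\int_{\{W_i\ge W_j\}}W_i^{\tilde s}W_j^{\tilde t}\lesssim Q_{ij}^{\tilde t}$ if $\tilde s>\tilde t$, and $\int_{\{W_i\ge W_j\}}W_i^{\tilde s}W_j^{\tilde t}\lesssim Q_{ij}^{n/(n-2s)}$ if $\tilde s<\tilde t$. -/

import Mathlib

noncomputable section
open MeasureTheory Real Filter
open scoped FourierTransform Topology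

namespace NonlocalSobolev

abbrev E (n : ℕ) := EuclideanSpace ℝ (Fin n)

/-- Riesz-type convolution `(|x|^{-μ} ∗ f)(x) = ∫ |x-y|^{-μ} f(y) dy`. -/
def rieszConv (n : ℕ) (μ : ℝ) (f : E n → ℝ) (x : E n) : ℝ :=
  ∫ y : E n, ‖x - y‖ ^ (-μ) * f y

/-- Fourier transform of a real-valued function. -/
def ft (n : ℕ) (u : E n → ℝ) : E n → ℂ :=
  𝓕 (fun x => (u x : ℂ))

/-- Squared homogeneous Sobolev norm `‖u‖_{Ḣ^s}^2 = ∫ |û(ξ)|^2 |ξ|^{2s} dξ`. -/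
def hsNormSq (n : ℕ) (s : ℝ) (u : E n → ℝ) : ℝ :=
  ∫ ξ : E n, ‖ft n u ξ‖ ^ 2 * ‖ξ‖ ^ (2 * s)

/-- Homogeneous Sobolev norm. -/
def hsNorm (n : ℕ) (s : ℝ) (u : E n → ℝ) : ℝ := Real.sqrt (hsNormSq n s u)

/-- The `Ḣ^s` inner product. -/
def hsInner (n : ℕ) (s : ℝ) (u v : E n → ℝ) : ℝ :=
  ∫ ξ : E n, (ft n u ξ * (starRingEnd ℂ) (ft n v ξ)).re * ‖ξ‖ ^ (2 * s)

/-- The fractional Laplacian `(-Δ)^s u` defined as a Fourier multiplier. -/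
def fracLaplacian (n : ℕ) (s : ℝ) (u : E n → ℝ) (x : E n) : ℝ :=
  (𝓕⁻ (fun ξ : E n => ((‖ξ‖ ^ (2 * s) : ℝ) : ℂ) * ft n u ξ) x).re

/-- Membership in `Ḣ^s(ℝⁿ)`: the Fourier-side energy density is integrable. -/
def MemHs (n : ℕ) (s : ℝ) (u : E n → ℝ) : Prop :=
  Integrable (fun ξ : E n => ‖ft n u ξ‖ ^ 2 * ‖ξ‖ ^ (2 * s))

/-- The dual `Ḣ^{-s}` norm, via duality against the unit ball of `Ḣ^s`. -/
def dualNorm (n : ℕ) (s : ℝ) (f : E n → ℝ) : ℝ :=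
  sSup { r | ∃ v : E n → ℝ, MemHs n s v ∧ hsNormSq n s v ≤ 1 ∧ r = ∫ x : E n, f x * v x }

/-- The critical Hartree exponent `p_s = (2n-μ)/(n-2s)`. -/
def pExp (n : ℕ) (s μ : ℝ) : ℝ := (2 * n - μ) / (n - 2 * s)

/-- The critical Sobolev exponent `2_s^* = 2n/(n-2s)`. -/
def twoStar (n : ℕ) (s : ℝ) : ℝ := 2 * n / (n - 2 * s)

/-- The nonlocal Hartree energy `∫ (|x|^{-μ} ∗ |u|^{p_s}) |u|^{p_s}`. -/
def energy (n : ℕ) (s μ : ℝ) (u : E n → ℝ) : ℝ :=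
  ∫ x : E n, rieszConv n μ (fun y => |u y| ^ pExp n s μ) x * |u x| ^ pExp n s μ

/-- The explicit constant `α_{n,μ,s}` in the bubble. -/
def alphaConst (n : ℕ) (s μ : ℝ) : ℝ :=
  ((2 ^ (2 * s) * Real.Gamma ((n + 2 * s) / 2) * Real.Gamma ((2 * n - μ) / 2)) /
      (Real.pi ^ ((n : ℝ) / 2) * Real.Gamma ((n - 2 * s) / 2) * Real.Gamma ((n - μ) / 2))) ^
    (((n : ℝ) - 2 * s) / (2 * ((n : ℝ) + 2 * s - μ)))

/-- The bubble `W[ξ,λ](x) = α_{n,μ,s} (λ/(1+λ²|x-ξ|²))^{(n-2s)/2}`. -/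
def bubble (n : ℕ) (s μ : ℝ) (ξ : E n) (lam : ℝ) (x : E n) : ℝ :=
  alphaConst n s μ * (lam / (1 + lam ^ 2 * ‖x - ξ‖ ^ 2)) ^ (((n : ℝ) - 2 * s) / 2)

/-- `∂_λ W[ξ,λ]`. -/
def bubbleDLam (n : ℕ) (s μ : ℝ) (ξ : E n) (lam : ℝ) (x : E n) : ℝ :=
  deriv (fun t : ℝ => bubble n s μ ξ t x) lam

/-- `∂_{ξ_j} W[ξ,λ]`. -/
def bubbleDXi (n : ℕ) (s μ : ℝ) (ξ : E n) (lam : ℝ) (j : Fin n) (x : E n) : ℝ :=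
  deriv (fun t : ℝ => bubble n s μ (ξ + t • EuclideanSpace.single j (1 : ℝ)) lam x) 0

/-- The interaction quantity `Q_{ij}`. -/
def Qij (n : ℕ) (s : ℝ) (ξi ξj : E n) (li lj : ℝ) : ℝ :=
  (li / lj + lj / li + li * lj * ‖ξi - ξj‖ ^ 2) ^ (-(((n : ℝ) - 2 * s)) / 2)

/-- `C` is the optimal constant in the nonlocal Sobolev (HLS-type) inequality. -/
def IsOptimalHLS (n : ℕ) (s μ : ℝ) (C : ℝ) : Prop :=
  0 < C ∧
    (∀ u : E n → ℝ, MemHs n s u →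
      C * (energy n s μ u) ^ (1 / pExp n s μ) ≤ hsNormSq n s u) ∧
    ∀ C' : ℝ,
      (∀ u : E n → ℝ, MemHs n s u →
        C' * (energy n s μ u) ^ (1 / pExp n s μ) ≤ hsNormSq n s u) → C' ≤ C

lemma scale_integral (n : ℕ) (q : ℝ) (hq : 0 < q) (η : E n) (g : E n → ℝ) :
    ∫ x : E n, q ^ (n : ℝ) * g (q • (x - η)) = ∫ y : E n, g y := by
  rw [integral_const_mul, integral_sub_right_eq_self (fun x => g (q • x)) η,
    Measure.integral_comp_smul_of_nonneg volume g q (hR := hq.le)]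
  simp only [finrank_euclideanSpace, Fintype.card_fin, smul_eq_mul, rpow_natCast]
  field_simp

lemma scale_integrable (n : ℕ) (q : ℝ) (hq : 0 < q) (η : E n) (g : E n → ℝ)
    (hg : Integrable g) :
    Integrable (fun x : E n => q ^ (n : ℝ) * g (q • (x - η))) :=
  ((hg.comp_smul hq.ne').comp_sub_right η).const_mul _

lemma far_integral (n : ℕ) (b : ℝ) (hb : (n : ℝ) / 2 < b) :
    ∃ K : ℝ, 0 ≤ K ∧ ∀ m : ℝ, 0 < m →
      Integrable (fun y : E n => (m + ‖y‖ ^ 2) ^ (-b)) ∧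
      ∫ y : E n, (m + ‖y‖ ^ 2) ^ (-b) = K * m ^ ((n : ℝ) / 2 - b) := by
  have h1 : Integrable (fun y : E n => (1 + ‖y‖ ^ 2) ^ (-b)) := by
    have := integrable_rpow_neg_one_add_norm_sq (E := E n) (μ := volume) (r := 2 * b)
      (by simp; linarith)
    convert this using 3
    ring
  refine ⟨∫ y : E n, (1 + ‖y‖ ^ 2) ^ (-b), integral_nonneg fun y => by positivity, ?_⟩
  intro m hm
  set q : ℝ := m ^ (-(1 / 2 : ℝ)) with hq
  have hq0 : 0 < q := by positivity
  have hq2 : q ^ 2 = m⁻¹ := by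
    rw [hq, ← rpow_natCast, ← rpow_mul hm.le, ← rpow_neg_one]; norm_num
  have key : (fun y : E n => (m + ‖y‖ ^ 2) ^ (-b)) =
      fun y : E n => m ^ ((n : ℝ) / 2 - b) *
        (q ^ (n : ℝ) * (fun z : E n => (1 + ‖z‖ ^ 2) ^ (-b)) (q • (y - 0))) := by
    ext y
    have e1 : m + ‖y‖ ^ 2 = m * (1 + ‖q • (y - 0)‖ ^ 2) := by
      rw [norm_smul, sub_zero, mul_pow, norm_of_nonneg hq0.le, hq2]
      field_simp
    have e2 : q ^ (n : ℝ) = m ^ (-(n : ℝ) / 2) := by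
      rw [hq, ← rpow_mul hm.le]; congr 1; ring
    dsimp only
    rw [e1, mul_rpow hm.le (by positivity), e2, ← mul_assoc, ← rpow_add hm]
    congr 2; ring
  rw [key]
  refine ⟨(scale_integrable n q hq0 0 _ h1).const_mul _, ?_⟩
  rw [integral_const_mul, scale_integral n q hq0 0 (fun z : E n => (1 + ‖z‖ ^ 2) ^ (-b)), mul_comm]

lemma near_integral (n : ℕ) (hn : 0 < n) (a : ℝ) (ha : a < (n : ℝ) / 2) :
    ∃ K : ℝ, 0 ≤ K ∧ ∀ (ρ : ℝ) (e : E n), 0 < ρ →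
      Integrable (fun y : E n => if ‖y - e‖ ^ 2 ≤ ρ then (‖y - e‖ ^ 2) ^ (-a) else 0) ∧
      ∫ y : E n, (if ‖y - e‖ ^ 2 ≤ ρ then (‖y - e‖ ^ 2) ^ (-a) else 0)
        = K * ρ ^ ((n : ℝ) / 2 - a) := by
  have h1 : Integrable (fun y : E n => if ‖y‖ ^ 2 ≤ 1 then (‖y‖ ^ 2) ^ (-a) else 0) := by
    have hE : Module.finrank ℝ (E n) = n := by simp
    have h := integrableOn_ball_of_norm_le_rpow (E := E n) (F := ℝ) (μ := volume)
      (by omega) (f := fun y : E n => (‖y‖ ^ 2) ^ (-a)) (C := 1) (α := 2 * a) (r := 2)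
      (by rw [hE]; linarith) (Eventually.of_forall fun y => by
        rw [norm_of_nonneg (by positivity), one_mul, ← rpow_natCast, ← rpow_mul (norm_nonneg _)]
        apply le_of_eq; congr 1; push_cast; ring)
      (by apply Measurable.aestronglyMeasurable; fun_prop)
    have h2 : MeasurableSet {y : E n | ‖y‖ ^ 2 ≤ 1} :=
      measurableSet_le (by fun_prop) (by fun_prop)
    have h3 : IntegrableOn (fun y : E n => (‖y‖ ^ 2) ^ (-a)) {y : E n | ‖y‖ ^ 2 ≤ 1} := by
      refine h.mono_set fun y hy => ?_
      simp only [Set.mem_ofPred_eq] at hy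
      rw [mem_ball_zero_iff]
      nlinarith [norm_nonneg y]
    rw [← integrable_indicator_iff h2] at h3
    refine h3.congr (Eventually.of_forall fun y => ?_)
    simp [Set.indicator]
  refine ⟨∫ y : E n, (if ‖y‖ ^ 2 ≤ 1 then (‖y‖ ^ 2) ^ (-a) else 0),
    integral_nonneg fun y => by dsimp only; split_ifs <;> positivity, ?_⟩
  intro m e hm
  set q : ℝ := m ^ (-(1 / 2 : ℝ)) with hq
  have hq0 : 0 < q := by positivity
  have hq2 : q ^ 2 = m⁻¹ := by
    rw [hq, ← rpow_natCast, ← rpow_mul hm.le, ← rpow_neg_one]; norm_num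
  have key : (fun y : E n => if ‖y - e‖ ^ 2 ≤ m then (‖y - e‖ ^ 2) ^ (-a) else 0) =
      fun y : E n => m ^ ((n : ℝ) / 2 - a) *
        (q ^ (n : ℝ) * (fun z : E n => if ‖z‖ ^ 2 ≤ 1 then (‖z‖ ^ 2) ^ (-a) else 0)
          (q • (y - e))) := by
    ext y
    have e1 : ‖y - e‖ ^ 2 = m * (‖q • (y - e)‖ ^ 2) := by
      rw [norm_smul, mul_pow, norm_of_nonneg hq0.le, hq2]
      field_simp
    have e2 : q ^ (n : ℝ) = m ^ (-(n : ℝ) / 2) := by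
      rw [hq, ← rpow_mul hm.le]; congr 1; ring
    have e3 : ‖y - e‖ ^ 2 ≤ m ↔ ‖q • (y - e)‖ ^ 2 ≤ 1 := by
      rw [e1]; constructor <;> intro h <;> nlinarith
    dsimp only
    by_cases h : ‖y - e‖ ^ 2 ≤ m
    · rw [if_pos h, if_pos (e3.1 h), e1, mul_rpow hm.le (by positivity), e2, ← mul_assoc,
        ← rpow_add hm]
      congr 2; ring
    · rw [if_neg h, if_neg (fun h' => h (e3.2 h'))]; simp
  rw [key]
  refine ⟨(scale_integrable n q hq0 e _ h1).const_mul _, ?_⟩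
  rw [integral_const_mul, scale_integral n q hq0 e
    (fun z : E n => if ‖z‖ ^ 2 ≤ 1 then (‖z‖ ^ 2) ^ (-a) else 0), mul_comm]

/-- negative powers reverse the order -/
lemma rpow_neg_anti {x y c : ℝ} (hx : 0 < x) (hxy : x ≤ y) (hc : 0 ≤ c) :
    y ^ (-c) ≤ x ^ (-c) :=
  rpow_le_rpow_of_nonpos hx hxy (by linarith)

/-- the normalised interaction quantity is controlled by the two denominators -/
lemma R_le (n : ℕ) (l : ℝ) (hl : 0 < l) (e y : E n) :
    l⁻¹ + l + l * ‖e‖ ^ 2 ≤ 2 * (l⁻¹ + l * ‖y - e‖ ^ 2) + 2 * (l * (1 + ‖y‖ ^ 2)) := by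
  have h1 : ‖e‖ ≤ ‖y‖ + ‖y - e‖ := by
    have := norm_sub_le y (y - e); simpa using this
  have h2 : ‖e‖ ^ 2 ≤ 2 * ‖y‖ ^ 2 + 2 * ‖y - e‖ ^ 2 := by
    nlinarith [norm_nonneg e, norm_nonneg y, norm_nonneg (y - e), sq_nonneg (‖y‖ - ‖y - e‖)]
  have h3 : 0 < l⁻¹ := by positivity
  nlinarith [mul_le_mul_of_nonneg_left h2 hl.le]

lemma core_one (n : ℕ) (hn : 0 < n) (a b : ℝ) (hb : 0 ≤ b) (hbn : b < (n : ℝ) / 2)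
    (hab : a + b = n) :
    ∃ C : ℝ, 0 ≤ C ∧ ∀ (l : ℝ) (e : E n), 0 < l → ∃ g : E n → ℝ, Integrable g ∧
      (∀ y, 0 ≤ g y) ∧ ∫ y, g y ≤ C * (l⁻¹ + l + l * ‖e‖ ^ 2) ^ (-b) ∧
      ∀ y, y ≠ e → (1 + ‖y‖ ^ 2) ^ (-a) * (l⁻¹ + l * ‖y - e‖ ^ 2) ^ (-b) ≤ g y := by
  have ha : (n : ℝ) / 2 < a := by linarith
  have ha0 : 0 ≤ a := by linarith
  obtain ⟨K1, hK1, H1⟩ := far_integral n a ha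
  obtain ⟨K2, hK2, H2⟩ := near_integral n hn b hbn
  refine ⟨4 ^ b * K1 + 4 ^ a * K2, by positivity, ?_⟩
  intro l e hl
  set R := l⁻¹ + l + l * ‖e‖ ^ 2 with hR
  have hli : 0 < l⁻¹ := by positivity
  have hR0 : 0 < R := by positivity
  set M := R / l with hM
  have hM0 : 0 < M := by positivity
  have hRM : R = l * M := by rw [hM]; field_simp
  have hM1 : 1 ≤ M := by
    rw [hM, le_div_iff₀ hl]
    have : 0 ≤ l * ‖e‖ ^ 2 := by positivity
    linarith
  obtain ⟨I1, J1⟩ := H1 1 one_pos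
  obtain ⟨I2, J2⟩ := H2 M e hM0
  rw [one_rpow, mul_one] at J1
  refine ⟨fun y => (4 ^ b * R ^ (-b)) * (1 + ‖y‖ ^ 2) ^ (-a) +
    (4 ^ a * M ^ (-a) * l ^ (-b)) * (if ‖y - e‖ ^ 2 ≤ M then (‖y - e‖ ^ 2) ^ (-b) else 0),
    (I1.const_mul _).add (I2.const_mul _), fun y => ?_, ?_, ?_⟩
  · dsimp only; split_ifs <;> positivity
  · rw [integral_add (I1.const_mul _) (I2.const_mul _), integral_const_mul, integral_const_mul,
      J1, J2]
    have : M ^ (-a) * l ^ (-b) * M ^ ((n : ℝ) / 2 - b) ≤ R ^ (-b) := by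
      rw [hRM, mul_rpow hl.le hM0.le]
      have : M ^ (-a) * M ^ ((n : ℝ) / 2 - b) ≤ M ^ (-b) := by
        rw [← rpow_add hM0]
        exact rpow_le_rpow_of_exponent_le hM1 (by linarith)
      have h := mul_le_mul_of_nonneg_left this (by positivity : 0 ≤ l ^ (-b))
      linarith
    have h := mul_le_mul_of_nonneg_left this (by positivity : 0 ≤ 4 ^ a * K2)
    linarith
  · intro y hy
    have hye : 0 < ‖y - e‖ ^ 2 := by
      have := norm_pos_iff.2 (sub_ne_zero.2 hy); positivity
    dsimp only
    by_cases hv : R / 4 ≤ l⁻¹ + l * ‖y - e‖ ^ 2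
    · have h1 : (l⁻¹ + l * ‖y - e‖ ^ 2) ^ (-b) ≤ 4 ^ b * R ^ (-b) := by
        refine (rpow_neg_anti (by positivity) hv hb).trans (le_of_eq ?_)
        rw [div_rpow hR0.le (by norm_num), rpow_neg (by norm_num : (0 : ℝ) ≤ 4)]
        field_simp
      have h2 := mul_le_mul_of_nonneg_left h1 (by positivity : 0 ≤ (1 + ‖y‖ ^ 2) ^ (-a))
      have h3 : 0 ≤ (4 ^ a * M ^ (-a) * l ^ (-b)) *
          (if ‖y - e‖ ^ 2 ≤ M then (‖y - e‖ ^ 2) ^ (-b) else 0) := by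
        split_ifs <;> positivity
      linarith
    · push Not at hv
      have hy2 : ‖y - e‖ ^ 2 ≤ M := by
        rw [hM, le_div_iff₀ hl]; linarith
      have hu : M / 4 ≤ 1 + ‖y‖ ^ 2 := by
        have := R_le n l hl e y
        rw [← hR] at this
        have : R / 4 ≤ l * (1 + ‖y‖ ^ 2) := by linarith
        rw [hRM, mul_div_assoc] at this
        exact le_of_mul_le_mul_left this hl
      rw [if_pos hy2]
      have h1 : (1 + ‖y‖ ^ 2) ^ (-a) ≤ 4 ^ a * M ^ (-a) := by
        refine (rpow_neg_anti (by positivity) hu ha0).trans (le_of_eq ?_)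
        rw [div_rpow hM0.le (by norm_num), rpow_neg (by norm_num : (0 : ℝ) ≤ 4)]
        field_simp
      have h2 : (l⁻¹ + l * ‖y - e‖ ^ 2) ^ (-b) ≤ l ^ (-b) * (‖y - e‖ ^ 2) ^ (-b) := by
        rw [← mul_rpow hl.le hye.le]
        exact rpow_neg_anti (by positivity) (by linarith) hb
      have h3 := mul_le_mul h1 h2 (by positivity) (by positivity)
      have h4 : 0 ≤ (4 ^ b * R ^ (-b)) * (1 + ‖y‖ ^ 2) ^ (-a) := by positivity
      linarith

lemma core_two (n : ℕ) (hn : 0 < n) (a b : ℝ) (ha0 : 0 ≤ a) (han : a < (n : ℝ) / 2)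
    (hab : a + b = n) :
    ∃ C : ℝ, 0 ≤ C ∧ ∀ (l : ℝ) (e : E n), 0 < l → ∃ g : E n → ℝ, Integrable g ∧
      (∀ y, 0 ≤ g y) ∧ ∫ y, g y ≤ C * (l⁻¹ + l + l * ‖e‖ ^ 2) ^ (-((n : ℝ) / 2)) ∧
      ∀ y, y ≠ e → l⁻¹ + l * ‖y - e‖ ^ 2 ≤ 1 + ‖y‖ ^ 2 →
        (l⁻¹ + l * ‖y - e‖ ^ 2) ^ (-a) * (1 + ‖y‖ ^ 2) ^ (-b) ≤ g y := by
  have hbn : (n : ℝ) / 2 < b := by linarith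
  have hb0 : 0 ≤ b := by linarith
  obtain ⟨K1, hK1, H1⟩ := far_integral n b hbn
  obtain ⟨K2, hK2, H2⟩ := near_integral n hn a han
  refine ⟨4 ^ a * 11 ^ b * K1 + 4 ^ b * 4 ^ ((n : ℝ) / 2 - a) * K2, by positivity, ?_⟩
  intro l e hl
  set R := l⁻¹ + l + l * ‖e‖ ^ 2 with hR
  have hli : 0 < l⁻¹ := by positivity
  have hR0 : 0 < R := by positivity
  set M := R / l with hM
  have hM0 : 0 < M := by positivity
  have hRM : R = l * M := by rw [hM]; field_simp
  obtain ⟨I1, J1⟩ := H1 R hR0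
  obtain ⟨I2, J2⟩ := H2 (4 * M / l) e (by positivity)
  refine ⟨fun y => (4 ^ a * 11 ^ b * R ^ (-a)) * (R + ‖y‖ ^ 2) ^ (-b) +
    (4 ^ b * M ^ (-b) * l ^ (-a)) *
      (if ‖y - e‖ ^ 2 ≤ 4 * M / l then (‖y - e‖ ^ 2) ^ (-a) else 0),
    (I1.const_mul _).add (I2.const_mul _), fun y => ?_, ?_, ?_⟩
  · dsimp only; split_ifs <;> positivity
  · rw [integral_add (I1.const_mul _) (I2.const_mul _), integral_const_mul, integral_const_mul,
      J1, J2]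
    have e1 : R ^ (-a) * R ^ ((n : ℝ) / 2 - b) = R ^ (-((n : ℝ) / 2)) := by
      rw [← rpow_add hR0]; congr 1; linarith
    have e2 : M ^ (-b) * l ^ (-a) * (4 * M / l) ^ ((n : ℝ) / 2 - a) =
        4 ^ ((n : ℝ) / 2 - a) * R ^ (-((n : ℝ) / 2)) := by
      rw [div_rpow (x := 4 * M) (by positivity) hl.le, mul_rpow (x := 4) (by norm_num) hM0.le, hRM,
        mul_rpow hl.le hM0.le, div_eq_mul_inv, ← rpow_neg hl.le]
      have f1 : M ^ (-((n : ℝ) / 2)) = M ^ (-b) * M ^ ((n : ℝ) / 2 - a) := by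
        rw [← rpow_add hM0]; congr 1; linarith
      have f2 : l ^ (-((n : ℝ) / 2)) = l ^ (-a) * l ^ (-((n : ℝ) / 2 - a)) := by
        rw [← rpow_add hl]; congr 1; linarith
      rw [f1, f2]; ring
    apply le_of_eq
    linear_combination (4 ^ a * 11 ^ b * K1) * e1 + (4 ^ b * K2) * e2
  · intro y hy huv
    have hye : 0 < ‖y - e‖ ^ 2 := by
      have := norm_pos_iff.2 (sub_ne_zero.2 hy); positivity
    have hRle := R_le n l hl e y
    rw [← hR] at hRle
    dsimp only
    by_cases hv : l ≤ 4 ∧ R / 4 ≤ l⁻¹ + l * ‖y - e‖ ^ 2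
    · obtain ⟨hl4, hv⟩ := hv
      have h1 : (l⁻¹ + l * ‖y - e‖ ^ 2) ^ (-a) ≤ 4 ^ a * R ^ (-a) := by
        refine (rpow_neg_anti (by positivity) hv ha0).trans (le_of_eq ?_)
        rw [div_rpow hR0.le (by norm_num), rpow_neg (by norm_num : (0 : ℝ) ≤ 4)]
        field_simp
      have h5 : (R + ‖y‖ ^ 2) / 11 ≤ 1 + ‖y‖ ^ 2 := by
        have : l * (1 + ‖y‖ ^ 2) ≤ 4 * (1 + ‖y‖ ^ 2) :=
          mul_le_mul_of_nonneg_right hl4 (by positivity)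
        linarith
      have h6 : (1 + ‖y‖ ^ 2) ^ (-b) ≤ 11 ^ b * (R + ‖y‖ ^ 2) ^ (-b) := by
        refine (rpow_neg_anti (by positivity) h5 hb0).trans (le_of_eq ?_)
        rw [div_rpow (by positivity) (by norm_num), rpow_neg (by norm_num : (0 : ℝ) ≤ 11)]
        field_simp
      have h2 := mul_le_mul h1 h6 (by positivity) (by positivity)
      have h3 : 0 ≤ (4 ^ b * M ^ (-b) * l ^ (-a)) *
          (if ‖y - e‖ ^ 2 ≤ 4 * M / l then (‖y - e‖ ^ 2) ^ (-a) else 0) := by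
        split_ifs <;> positivity
      linarith
    · have hboth : ‖y - e‖ ^ 2 ≤ 4 * M / l ∧ R / 4 ≤ l * (1 + ‖y‖ ^ 2) := by
        by_cases hl4 : l ≤ 4
        · have hv' : l⁻¹ + l * ‖y - e‖ ^ 2 < R / 4 := by
            by_contra h; exact hv ⟨hl4, not_lt.1 h⟩
          refine ⟨?_, by linarith⟩
          have h1 : ‖y - e‖ ^ 2 ≤ M := by
            rw [hM, le_div_iff₀ hl]; linarith
          rw [le_div_iff₀ hl]
          nlinarith
        · push Not at hl4
          refine ⟨?_, ?_⟩
          · have h2 : ‖y‖ ^ 2 ≤ 2 * ‖e‖ ^ 2 + 2 * ‖y - e‖ ^ 2 := by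
              have h1 : ‖y‖ ≤ ‖e‖ + ‖y - e‖ := by
                have := norm_add_le e (y - e); simpa using this
              nlinarith [norm_nonneg e, norm_nonneg y, norm_nonneg (y - e),
                sq_nonneg (‖e‖ - ‖y - e‖)]
            have h3 : 1 + ‖e‖ ^ 2 ≤ M := by
              rw [hM, le_div_iff₀ hl]; linarith
            rw [le_div_iff₀ hl]
            nlinarith
          · nlinarith [sq_nonneg ‖y‖]
      obtain ⟨hy2, hu⟩ := hboth
      have hu : M / 4 ≤ 1 + ‖y‖ ^ 2 := by
        rw [hRM, mul_div_assoc] at hu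
        exact le_of_mul_le_mul_left hu hl
      rw [if_pos hy2]
      have h1 : (1 + ‖y‖ ^ 2) ^ (-b) ≤ 4 ^ b * M ^ (-b) := by
        refine (rpow_neg_anti (by positivity) hu hb0).trans (le_of_eq ?_)
        rw [div_rpow hM0.le (by norm_num), rpow_neg (by norm_num : (0 : ℝ) ≤ 4)]
        field_simp
      have h2 : (l⁻¹ + l * ‖y - e‖ ^ 2) ^ (-a) ≤ l ^ (-a) * (‖y - e‖ ^ 2) ^ (-a) := by
        rw [← mul_rpow hl.le hye.le]
        exact rpow_neg_anti (by positivity) (by linarith) ha0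
      have h3 := mul_le_mul h2 h1 (by positivity) (by positivity)
      have h4 : 0 ≤ (4 ^ a * 11 ^ b * R ^ (-a)) * (R + ‖y‖ ^ 2) ^ (-b) := by positivity
      linarith

lemma alpha_pos (n : ℕ) (s μ : ℝ) (hs : 0 < s) (hns : 2 * s < n) (hμn : μ < n) :
    0 < alphaConst n s μ := by
  unfold alphaConst
  have h1 : 0 < Real.Gamma (((n : ℝ) + 2 * s) / 2) := Gamma_pos_of_pos (by linarith)
  have h2 : 0 < Real.Gamma ((2 * (n : ℝ) - μ) / 2) := Gamma_pos_of_pos (by linarith)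
  have h3 : 0 < Real.Gamma (((n : ℝ) - 2 * s) / 2) := Gamma_pos_of_pos (by linarith)
  have h4 : 0 < Real.Gamma (((n : ℝ) - μ) / 2) := Gamma_pos_of_pos (by linarith)
  positivity

lemma bubble_measurable (n : ℕ) (s μ : ℝ) (ξ : E n) (lam : ℝ) :
    Measurable (bubble n s μ ξ lam) := by
  unfold bubble; fun_prop

/-- bubble in coordinates centred at another bubble -/
lemma bubble_norm (n : ℕ) (s μ : ℝ) (ξ η x : E n) (p q : ℝ) (hp : 0 < p) (hq : 0 < q) :
    bubble n s μ ξ p x = alphaConst n s μ *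
      (q * ((p / q)⁻¹ + (p / q) * ‖q • (x - η) - q • (ξ - η)‖ ^ 2)⁻¹)
        ^ (((n : ℝ) - 2 * s) / 2) := by
  unfold bubble
  congr 2
  rw [← smul_sub, norm_smul, norm_of_nonneg hq.le]
  have : x - η - (ξ - η) = x - ξ := by abel
  rw [this]
  field_simp

lemma bubble_norm_self (n : ℕ) (s μ : ℝ) (η x : E n) (q : ℝ) (hq : 0 < q) :
    bubble n s μ η q x = alphaConst n s μ *
      (q * (1 + ‖q • (x - η)‖ ^ 2)⁻¹) ^ (((n : ℝ) - 2 * s) / 2) := by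
  unfold bubble
  congr 2
  rw [norm_smul, norm_of_nonneg hq.le]
  field_simp

lemma prod_pow (A k q u v st tt : ℝ) (hA : 0 < A) (hq : 0 < q) (hu : 0 < u) (hv : 0 < v) :
    (A * (q * u⁻¹) ^ k) ^ st * (A * (q * v⁻¹) ^ k) ^ tt =
      A ^ (st + tt) * (q ^ (k * st + k * tt) * (u ^ (-(k * st)) * v ^ (-(k * tt)))) := by
  rw [mul_rpow hA.le (by positivity), mul_rpow hA.le (by positivity),
    ← rpow_mul (by positivity), ← rpow_mul (by positivity),
    mul_rpow hq.le (by positivity), mul_rpow hq.le (by positivity),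
    rpow_add hA, rpow_add hq, inv_rpow hu.le, inv_rpow hv.le, rpow_neg hu.le, rpow_neg hv.le]
  ring

lemma Q_rpow (n : ℕ) (s : ℝ) (ξi ξj : E n) (p q t : ℝ) (hp : 0 < p) (hq : 0 < q) :
    Qij n s ξi ξj p q ^ t = ((p / q)⁻¹ + p / q + (p / q) * ‖q • (ξi - ξj)‖ ^ 2)
      ^ (-((((n : ℝ) - 2 * s) / 2) * t)) := by
  unfold Qij
  rw [← rpow_mul (by positivity)]
  congr 1
  · rw [norm_smul, norm_of_nonneg hq.le]; field_simp; ring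
  · ring

lemma Q_symm (n : ℕ) (s : ℝ) (ξi ξj : E n) (p q : ℝ) :
    Qij n s ξi ξj p q = Qij n s ξj ξi q p := by
  unfold Qij
  rw [norm_sub_rev ξi ξj]; congr 1; ring

lemma set_bound (n : ℕ) (hn : 0 < n) (B q : ℝ) (hB : 0 ≤ B) (hq : 0 < q) (η ξ : E n)
    (G : Set (E n)) (hG : MeasurableSet G) (T g : E n → ℝ) (hT : ∀ x, 0 ≤ T x)
    (hg : Integrable g) (hg0 : ∀ y, 0 ≤ g y)
    (h : ∀ x, x ≠ ξ → x ∈ G → T x ≤ B * (q ^ (n : ℝ) * g (q • (x - η)))) :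
    ∫ x in G, T x ≤ B * ∫ y, g y := by
  have : Nonempty (Fin n) := ⟨⟨0, hn⟩⟩
  have hI := (scale_integrable n q hq η g hg).const_mul B
  rw [← scale_integral n q hq η g, ← integral_const_mul]
  refine le_trans (integral_mono_of_nonneg (Eventually.of_forall hT) hI.integrableOn ?_)
    (setIntegral_le_integral hI (Eventually.of_forall fun x => ?_))
  · have h1 : ∀ᵐ x : E n, x ≠ ξ := by
      rw [ae_iff]; simp
    refine (ae_restrict_iff' hG).2 ?_
    filter_upwards [h1] with x hx hxG using h x hx hxG
  · have := hg0 (q • (x - η)); simp only [Pi.zero_apply]; positivity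

/-- interaction integrals restricted to the region where `W_i` dominates. -/
theorem restricted_bubble_interaction (n : ℕ) (s μ : ℝ)
    (hs : 0 < s) (hns : 2 * s < n) (hμ0 : 0 < μ) (hμn : μ < n)
    (st tt : ℝ) (h0s : 0 ≤ st) (h0t : 0 ≤ tt) (hsum : st + tt = twoStar n s) :
    ∃ δ : ℝ, 0 < δ ∧ ∃ C : ℝ, 0 < C ∧
      ∀ (ξi ξj : E n) (li lj : ℝ), 0 < li → 0 < lj →
        Qij n s ξi ξj li lj ≤ δ →
        (tt < st →
          (∫ x in {x : E n | bubble n s μ ξj lj x ≤ bubble n s μ ξi li x},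
              bubble n s μ ξi li x ^ st * bubble n s μ ξj lj x ^ tt)
            ≤ C * Qij n s ξi ξj li lj ^ tt) ∧
        (st < tt →
          (∫ x in {x : E n | bubble n s μ ξj lj x ≤ bubble n s μ ξi li x},
              bubble n s μ ξi li x ^ st * bubble n s μ ξj lj x ^ tt)
            ≤ C * Qij n s ξi ξj li lj ^ ((n : ℝ) / ((n : ℝ) - 2 * s))) := by
  have hn : 0 < n := by
    have : (0 : ℝ) < n := by linarith
    exact_mod_cast this
  set k : ℝ := ((n : ℝ) - 2 * s) / 2 with hk
  have hk0 : 0 < k := by rw [hk]; linarith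
  have hne : (n : ℝ) - 2 * s ≠ 0 := by linarith
  have hab : k * st + k * tt = n := by
    rw [← mul_add, hsum, hk, twoStar]; field_simp
  have hA := alpha_pos n s μ hs hns hμn
  set A := alphaConst n s μ with hAdef
  refine ⟨1, one_pos, ?_⟩
  have hmeas : ∀ (ξi ξj : E n) (li lj : ℝ),
      MeasurableSet {x : E n | bubble n s μ ξj lj x ≤ bubble n s μ ξi li x} :=
    fun ξi ξj li lj => measurableSet_le (bubble_measurable ..) (bubble_measurable ..)
  have hbn : ∀ (ξ : E n) (l : ℝ), 0 < l → ∀ x, 0 ≤ bubble n s μ ξ l x := by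
    intro ξ l hl x
    unfold bubble; rw [← hAdef]; positivity
  rcases lt_trichotomy tt st with hlt | heq | hlt
  · have h1 := mul_lt_mul_of_pos_left hlt hk0
    obtain ⟨C, hC, H⟩ := core_one n hn (k * st) (k * tt) (by positivity) (by linarith) hab
    refine ⟨A ^ (st + tt) * C + 1, by positivity, ?_⟩
    intro ξi ξj li lj hli hlj _
    refine ⟨fun _ => ?_, fun h => absurd h hlt.not_gt⟩
    obtain ⟨g, hg, hg0, hgi, hgb⟩ := H (lj / li) (li • (ξj - ξi)) (by positivity)
    rw [Q_symm, Q_rpow n s ξj ξi lj li tt hlj hli]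
    refine (set_bound n hn (A ^ (st + tt)) li (by positivity) hli ξi ξj _ (hmeas ξi ξj li lj) _ g
      (fun x => mul_nonneg (rpow_nonneg (hbn _ _ hli x) _) (rpow_nonneg (hbn _ _ hlj x) _))
      hg hg0 ?_).trans ?_
    · intro x hx _
      rw [bubble_norm n s μ ξj ξi x lj li hlj hli, bubble_norm_self n s μ ξi x li hli,
        ← hAdef, ← hk, prod_pow _ _ _ _ _ _ _ hA hli (by positivity) (by positivity), hab]
      have := hgb (li • (x - ξi)) (by
        intro h
        have h2 := smul_right_injective (E n) hli.ne' h
        exact hx (sub_left_injective h2))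
      gcongr
    · have := mul_le_mul_of_nonneg_left hgi (by positivity : 0 ≤ A ^ (st + tt))
      have h2 : 0 ≤ ((lj / li)⁻¹ + lj / li + lj / li * ‖li • (ξj - ξi)‖ ^ 2) ^ (-(k * tt)) := by
        positivity
      linarith
  · refine ⟨1, one_pos, fun ξi ξj li lj _ _ _ => ⟨fun h => absurd h (by simp [heq]),
      fun h => absurd h (by simp [heq])⟩⟩
  · have h1 := mul_lt_mul_of_pos_left hlt hk0
    obtain ⟨C, hC, H⟩ := core_two n hn (k * st) (k * tt) (by positivity) (by linarith) hab
    refine ⟨A ^ (st + tt) * C + 1, by positivity, ?_⟩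
    intro ξi ξj li lj hli hlj _
    refine ⟨fun h => absurd h hlt.not_gt, fun _ => ?_⟩
    obtain ⟨g, hg, hg0, hgi, hgb⟩ := H (li / lj) (lj • (ξi - ξj)) (by positivity)
    have hexp : k * ((n : ℝ) / ((n : ℝ) - 2 * s)) = (n : ℝ) / 2 := by
      rw [hk]; field_simp
    rw [Q_rpow n s ξi ξj li lj _ hli hlj, ← hk, hexp]
    refine (set_bound n hn (A ^ (st + tt)) lj (by positivity) hlj ξj ξi _ (hmeas ξi ξj li lj) _ g
      (fun x => mul_nonneg (rpow_nonneg (hbn _ _ hli x) _) (rpow_nonneg (hbn _ _ hlj x) _))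
      hg hg0 ?_).trans ?_
    · intro x hx hxG
      rw [Set.mem_ofPred_eq, bubble_norm n s μ ξi ξj x li lj hli hlj,
        bubble_norm_self n s μ ξj x lj hlj, ← hAdef, ← hk] at hxG
      have hxG := le_of_mul_le_mul_left hxG hA
      rw [rpow_le_rpow_iff (by positivity) (by positivity) hk0] at hxG
      have hxG := le_of_mul_le_mul_left hxG hlj
      rw [inv_le_inv₀ (by positivity) (by positivity)] at hxG
      rw [bubble_norm n s μ ξi ξj x li lj hli hlj, bubble_norm_self n s μ ξj x lj hlj,
        ← hAdef, ← hk, prod_pow _ _ _ _ _ _ _ hA hlj (by positivity) (by positivity), hab]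
      have := hgb (lj • (x - ξj)) (by
        intro h
        have h2 := smul_right_injective (E n) hlj.ne' h
        exact hx (sub_left_injective h2)) hxG
      gcongr
    · have := mul_le_mul_of_nonneg_left hgi (by positivity : 0 ≤ A ^ (st + tt))
      have h2 : 0 ≤ ((li / lj)⁻¹ + li / lj + li / lj * ‖lj • (ξi - ξj)‖ ^ 2)
          ^ (-((n : ℝ) / 2)) := by
        positivity
      linarith

end NonlocalSobolev
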